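/- arXiv:math/0511307 — 2 statements merged into one kernel-verified Lean document; each statement's English description precedes it below -/
import Mathlib

section
/- Let 𝒞 be a clutter with incidence matrix A having columns v_1,…,v_q ∈ {0,1}^n. If the set covering polyhedron Q(A) is an integral polyhedron and ℕ𝒜′ = ℤ^{n+1} ∩ ℝ_+𝒜′ (equivalently, the Rees algebra R[It] of the edge ideal of 𝒞 is normal), then 𝒞 has the max-flow min-cut property. -/
open Finset

/-- The family `E` of edges (indexed by `Fin q`) is a clutter on the vertex set `Fin n`:
edges are nonempty and none of them is included in another. -/
def IsClutter {n q : ℕ} (E : Fin q → Finset (Fin n)) : Prop :=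
  (∀ j, (E j).Nonempty) ∧ ∀ j j' : Fin q, E j ⊆ E j' → j = j'

/-- The columns `v₁, …, v_q ∈ {0,1}ⁿ` of the incidence matrix of the clutter with edges `E`:
the characteristic vectors of the edges. -/
def incidence {n q : ℕ} (E : Fin q → Finset (Fin n)) : Fin q → Fin n → ℝ :=
  fun j i => if i ∈ E j then 1 else 0

/-- A vector is integral if all its entries are integers. -/
def IsIntegralVec {m : ℕ} (x : Fin m → ℝ) : Prop := ∀ i, ∃ z : ℤ, x i = z

/-- The set covering polyhedron `Q(A) = {x ∈ ℝⁿ | x ≥ 0, xA ≥ 1}`. -/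
def coveringPolyhedron {n q : ℕ} (v : Fin q → Fin n → ℝ) : Set (Fin n → ℝ) :=
  {x | (∀ i, 0 ≤ x i) ∧ ∀ j, 1 ≤ ∑ i, x i * v j i}

/-- `Q(A)` is an integral polyhedron: all its vertices (extreme points) have integer
coordinates. -/
def IntegralPolyhedron {n q : ℕ} (v : Fin q → Fin n → ℝ) : Prop :=
  ∀ x ∈ Set.extremePoints ℝ (coveringPolyhedron v), IsIntegralVec x

/-- The clutter with edges `E` has the max-flow min-cut property: for every `α ∈ ℕⁿ`, both the
linear program `min {⟨α,x⟩ | x ≥ 0, xA ≥ 1}` and its dual `max {⟨y,1⟩ | y ≥ 0, Ay ≤ α}` have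
integral optimal solutions. -/
def HasMFMC {n q : ℕ} (E : Fin q → Finset (Fin n)) : Prop :=
  ∀ α : Fin n → ℕ,
    (∃ x : Fin n → ℝ, IsIntegralVec x ∧ (∀ i, 0 ≤ x i) ∧
      (∀ j, 1 ≤ ∑ i, x i * incidence E j i) ∧
      ∀ x' : Fin n → ℝ, (∀ i, 0 ≤ x' i) → (∀ j, 1 ≤ ∑ i, x' i * incidence E j i) →
        ∑ i, (α i : ℝ) * x i ≤ ∑ i, (α i : ℝ) * x' i) ∧
    (∃ y : Fin q → ℝ, IsIntegralVec y ∧ (∀ j, 0 ≤ y j) ∧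
      (∀ i, ∑ j, y j * incidence E j i ≤ α i) ∧
      ∀ y' : Fin q → ℝ, (∀ j, 0 ≤ y' j) → (∀ i, ∑ j, y' j * incidence E j i ≤ α i) →
        ∑ j, y' j ≤ ∑ j, y j)

/-- The Rees cone `ℝ₊𝒜′ ⊆ ℝ^{n+1}`: the set of all nonnegative real linear combinations of
`𝒜′ = {e₁, …, eₙ, (v₁,1), …, (v_q,1)}`. -/
def reesCone {n q : ℕ} (v : Fin q → Fin n → ℝ) : Set (Fin (n + 1) → ℝ) :=
  {x | ∃ (a : Fin n → ℝ) (b : Fin q → ℝ), (∀ i, 0 ≤ a i) ∧ (∀ j, 0 ≤ b j) ∧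
    x = (∑ i, a i • (Pi.single (Fin.castSucc i) 1 : Fin (n + 1) → ℝ)) +
        ∑ j, b j • (Fin.snoc (v j) 1 : Fin (n + 1) → ℝ)}

/-- The affine semigroup `ℕ𝒜′ ⊆ ℝ^{n+1}`: all linear combinations of
`𝒜′ = {e₁, …, eₙ, (v₁,1), …, (v_q,1)}` with nonnegative integer coefficients. -/
def reesSemigroup {n q : ℕ} (v : Fin q → Fin n → ℝ) : Set (Fin (n + 1) → ℝ) :=
  {x | ∃ (a : Fin n → ℕ) (b : Fin q → ℕ),
    x = (∑ i, (a i : ℝ) • (Pi.single (Fin.castSucc i) 1 : Fin (n + 1) → ℝ)) +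
        ∑ j, (b j : ℝ) • (Fin.snoc (v j) 1 : Fin (n + 1) → ℝ)}

/-- `ℕ𝒜′ = ℤ^{n+1} ∩ ℝ₊𝒜′`; equivalently, the Rees algebra `R[It]` is a normal domain. -/
def NormalReesAlgebra {n q : ℕ} (v : Fin q → Fin n → ℝ) : Prop :=
  reesSemigroup v = {x ∈ reesCone v | IsIntegralVec x}


lemma aux_trunc {n q : ℕ} (E : Fin q → Finset (Fin n)) (x : Fin n → ℝ)
    (hx : x ∈ coveringPolyhedron (incidence E)) :
    (fun i => min (x i) 1) ∈ coveringPolyhedron (incidence E) := by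
  obtain ⟨h0, h1⟩ := hx
  refine ⟨fun i => le_min (h0 i) zero_le_one, fun j => ?_⟩
  have hnn : ∀ i ∈ (univ : Finset (Fin n)), 0 ≤ min (x i) 1 * incidence E j i := by
    intro i _
    refine mul_nonneg (le_min (h0 i) zero_le_one) ?_
    unfold incidence; split_ifs <;> norm_num
  by_cases h : ∃ i ∈ E j, 1 ≤ x i
  · obtain ⟨i, hi, hxi⟩ := h
    have := Finset.single_le_sum hnn (Finset.mem_univ i)
    simpa [incidence, hi, min_eq_right hxi] using this
  · push Not at h
    refine (h1 j).trans (le_of_eq (Finset.sum_congr rfl fun i _ => ?_))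
    by_cases hi : i ∈ E j
    · simp only [min_eq_left (h i hi).le]
    · simp [incidence, hi]

/-- `Q ∩ [0,1]ⁿ`, and minimization of a nonnegative functional over a closed part. -/
lemma aux_extreme {n q : ℕ} (E : Fin q → Finset (Fin n)) (hE : ∀ j, (E j).Nonempty)
    (α : Fin n → ℝ) (hα : ∀ i, 0 ≤ α i) :
    ∃ x ∈ Set.extremePoints ℝ (coveringPolyhedron (incidence E)),
      ∀ x' ∈ coveringPolyhedron (incidence E), ∑ i, α i * x i ≤ ∑ i, α i * x' i := by
  set Q := coveringPolyhedron (incidence E) with hQ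
  have hQc : IsClosed Q := by
    have : Q = (⋂ i, {x : Fin n → ℝ | 0 ≤ x i}) ∩
        ⋂ j, {x : Fin n → ℝ | 1 ≤ ∑ i, x i * incidence E j i} := by
      ext x; simp [hQ, coveringPolyhedron]
    rw [this]
    refine IsClosed.inter (isClosed_iInter fun i => ?_) (isClosed_iInter fun j => ?_)
    · exact isClosed_le continuous_const (by fun_prop)
    · exact isClosed_le continuous_const (by fun_prop)
  have hbox : IsCompact (Set.Icc (0 : Fin n → ℝ) 1) := isCompact_Icc
  have htr : ∀ x ∈ Q, (fun i => min (x i) 1) ∈ Q ∩ Set.Icc (0 : Fin n → ℝ) 1 := fun x hx =>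
    ⟨aux_trunc E x hx, fun i => le_min (hx.1 i) zero_le_one, fun i => min_le_right _ _⟩
  have hne : (Q ∩ Set.Icc (0 : Fin n → ℝ) 1).Nonempty := by
    refine ⟨1, ⟨fun i => zero_le_one, fun j => ?_⟩, zero_le_one, le_rfl⟩
    have : 1 ≤ #(E j) := (hE j).card_pos
    simpa [incidence] using this
  obtain ⟨p, hp, hpmin⟩ := (hbox.inter_left hQc).exists_isMinOn hne
    (f := fun x : Fin n → ℝ => ∑ i, α i * x i) (by fun_prop)
  have hpm : ∀ x ∈ Q, ∑ i, α i * p i ≤ ∑ i, α i * x i := fun x hx =>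
    (hpmin (htr x hx)).trans
      (Finset.sum_le_sum fun i _ => mul_le_mul_of_nonneg_left (min_le_left _ _) (hα i))
  set m := ∑ i, α i * p i with hm
  have hMc : IsClosed (Q ∩ {x | ∑ i, α i * x i ≤ m}) :=
    hQc.inter (isClosed_le (by fun_prop) continuous_const)
  obtain ⟨r, hr, hrmin⟩ := (hbox.inter_left hMc).exists_isMinOn ⟨p, ⟨hp.1, hm.ge⟩, hp.2⟩
    (f := fun x : Fin n → ℝ => ∑ i, x i) (by fun_prop)
  have hrm : ∀ x ∈ Q, ∑ i, α i * x i ≤ m → ∑ i, r i ≤ ∑ i, x i := fun x hx hxm =>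
    (hrmin (show (fun i => min (x i) 1) ∈ _ from ⟨⟨(htr x hx).1, le_trans
      (Finset.sum_le_sum fun i _ => mul_le_mul_of_nonneg_left (min_le_left _ _) (hα i)) hxm⟩,
        (htr x hx).2⟩)).trans
      (Finset.sum_le_sum fun i _ => min_le_left _ _)
  set s := ∑ i, r i with hs
  let F : Set (Fin n → ℝ) := (Q ∩ {x | ∑ i, α i * x i ≤ m}) ∩ {x | ∑ i, x i ≤ s}
  have hFcl : IsClosed F := hMc.inter (isClosed_le (by fun_prop) continuous_const)
  have hFsub : F ⊆ Set.Icc (0 : Fin n → ℝ) (fun _ => s) := by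
    rintro x ⟨⟨hx, _⟩, hxs⟩
    exact ⟨hx.1, fun i => (Finset.single_le_sum (fun i _ => hx.1 i) (Finset.mem_univ i)).trans hxs⟩
  have hFcomp : IsCompact F := isCompact_Icc.of_isClosed_subset hFcl hFsub
  obtain ⟨x, hx⟩ := hFcomp.extremePoints_nonempty ⟨r, hr.1, hs.ge⟩
  have hxF : x ∈ F := hx.1
  refine ⟨x, ⟨hxF.1.1, ?_⟩, fun x' hx' => hxF.1.2.trans (hpm x' hx')⟩
  intro x₁ h₁ x₂ h₂ hseg
  have key : ∀ (c : Fin n → ℝ) (a b : ℝ), ∑ i, c i * (a • x₁ + b • x₂) i =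
      a * (∑ i, c i * x₁ i) + b * ∑ i, c i * x₂ i := by
    intro c a b
    rw [Finset.mul_sum, Finset.mul_sum, ← Finset.sum_add_distrib]
    refine Finset.sum_congr rfl fun i _ => ?_
    simp; ring
  have aux : ∀ (a b u v w : ℝ), 0 < a → 0 < b → a + b = 1 → w ≤ u → w ≤ v →
      a * u + b * v ≤ w → u ≤ w ∧ v ≤ w := by
    intro a b u v w ha hb hab hu hv h
    obtain rfl : b = 1 - a := by linarith
    constructor <;> nlinarith
  have hseg' := hseg
  obtain ⟨a, b, ha, hb, hab, rfl⟩ := hseg'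
  have e1 : ∑ i, α i * (a • x₁ + b • x₂) i ≤ m := hxF.1.2
  rw [key] at e1
  obtain ⟨f1, f2⟩ := aux a b _ _ m ha hb hab (hpm _ h₁) (hpm _ h₂) e1
  have e2 : ∑ i, (a • x₁ + b • x₂) i ≤ s := hxF.2
  have k2 := key 1 a b
  simp only [Pi.one_apply, one_mul] at k2
  rw [k2] at e2
  obtain ⟨g1, g2⟩ := aux a b _ _ s ha hb hab (hrm _ h₁ f1) (hrm _ h₂ f2) e2
  exact hx.2 ⟨⟨h₁, f1⟩, g1⟩ ⟨⟨h₂, f2⟩, g2⟩ hseg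

open scoped Pointwise in
lemma aux_duality {n q : ℕ} (v : Fin q → Fin n → ℝ) (α : Fin n → ℝ) (hα : ∀ i, 0 ≤ α i)
    (m : ℝ) (hm : 0 ≤ m) (hmin : ∀ x ∈ coveringPolyhedron v, m ≤ ∑ i, α i * x i) :
    ∃ y : Fin q → ℝ, (∀ j, 0 ≤ y j) ∧ ∑ j, y j = m ∧ ∀ i, ∑ j, y j * v j i ≤ α i := by
  rcases hm.eq_or_lt with rfl | hm
  · exact ⟨0, by simp, by simp, by simpa using hα⟩
  have hq : Nonempty (Fin q) := by
    by_contra h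
    rw [not_nonempty_iff] at h
    have := hmin 0 ⟨by simp, fun j => h.elim j⟩
    simp at this
    linarith
  obtain ⟨j0⟩ := hq
  let L : (Fin q → ℝ) →ₗ[ℝ] (Fin n → ℝ) :=
    { toFun := fun y i => m * ∑ j, y j * v j i
      map_add' := by intro y z; ext i; simp [add_mul, Finset.sum_add_distrib, mul_add]
      map_smul' := by
        intro c y; ext i
        simp only [Pi.smul_apply, smul_eq_mul, RingHom.id_apply, mul_assoc, ← Finset.mul_sum]
        ring }
  have hLc : Continuous L := L.continuous_of_finiteDimensional
  let D : Set (Fin n → ℝ) := L '' stdSimplex ℝ (Fin q) + Set.Ici 0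
  have hDcl : IsClosed D :=
    (isClosed_Ici).add_left_of_isCompact ((isCompact_stdSimplex ℝ (Fin q)).image hLc)
  have hDconv : Convex ℝ D := ((convex_stdSimplex ℝ (Fin q)).linear_image L).add (convex_Ici 0)
  by_cases hmem : α ∈ D
  · obtain ⟨_, ⟨y, hy, rfl⟩, d, hd, hyd⟩ := hmem
    refine ⟨fun j => m * y j, fun j => mul_nonneg hm.le (hy.1 j), ?_, fun i => ?_⟩
    · rw [← Finset.mul_sum, hy.2, mul_one]
    · have h1 : m * ∑ j, y j * v j i + d i = α i := congrFun hyd i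
      have h2 : 0 ≤ d i := hd i
      simp only [mul_assoc, ← Finset.mul_sum]
      linarith
  exfalso
  obtain ⟨f, u, hfu, hf⟩ := geometric_hahn_banach_point_closed hDconv hDcl hmem
  set c : Fin n → ℝ := fun i => f (Pi.single i 1) with hc
  have hfc : ∀ x, f x = ∑ i, c i * x i := by
    intro x
    conv_lhs => rw [pi_eq_sum_univ' x]
    rw [map_sum]
    refine Finset.sum_congr rfl fun i _ => ?_
    rw [map_smul, smul_eq_mul, mul_comm]
  have hsimp : ∀ j, (Pi.single j 1 : Fin q → ℝ) ∈ stdSimplex ℝ (Fin q) := fun j =>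
    single_mem_stdSimplex ℝ j
  have hLs : ∀ j, L (Pi.single j 1) = m • v j := by
    intro j; ext i
    simp [L, Pi.single_apply]
  have hfv : ∀ j, ∀ d ∈ Set.Ici (0 : Fin n → ℝ), u < m * f (v j) + f d := by
    intro j d hd
    have := hf _ (Set.add_mem_add (Set.mem_image_of_mem L (hsimp j)) hd)
    rwa [hLs, map_add, map_smul, smul_eq_mul] at this
  have hc0 : ∀ i, 0 ≤ c i := by
    intro i
    by_contra hneg
    push Not at hneg
    set K := m * f (v j0) - u with hK
    have hK0 : 0 < K := by
      have := hfv j0 0 (by simp)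
      simp at this; linarith
    have := hfv j0 ((K / (- c i)) • Pi.single i 1) (by
      have : 0 ≤ K / (- c i) := div_nonneg hK0.le (by linarith)
      intro k
      by_cases hk : k = i
      · subst hk; simpa using this
      · simp [Pi.single_apply, hk])
    rw [map_smul, smul_eq_mul] at this
    have h3 : K / (- c i) * c i = -K := by
      have hne := hneg.ne
      rw [div_neg, neg_mul, div_mul_cancel₀ _ hne]
    change u < m * f (v j0) + K / (- c i) * c i at this
    rw [h3] at this
    linarith
  have hfα : 0 ≤ f α := by
    rw [hfc]; exact Finset.sum_nonneg fun i _ => mul_nonneg (hc0 i) (hα i)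
  have hu : 0 < u := by linarith
  have hQ := hmin (fun i => m / u * c i) ⟨fun i => mul_nonneg (by positivity) (hc0 i), fun j => by
    have h := hfv j 0 (by simp)
    rw [map_zero, add_zero, hfc] at h
    simp only [mul_assoc, ← Finset.mul_sum]
    rw [div_mul_eq_mul_div, le_div_iff₀ hu]
    linarith⟩
  have : ∑ i, α i * (m / u * c i) = m / u * f α := by
    rw [hfc, Finset.mul_sum]
    exact Finset.sum_congr rfl fun i _ => by ring
  rw [this, div_mul_eq_mul_div, le_div_iff₀ hu] at hQ
  nlinarith

/-- Coordinates of a combination of the generators of the Rees cone. -/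
lemma aux_coord {n q : ℕ} (v : Fin q → Fin n → ℝ) (a : Fin n → ℝ) (b : Fin q → ℝ) :
    (∑ i, a i • (Pi.single (Fin.castSucc i) 1 : Fin (n + 1) → ℝ)) +
        ∑ j, b j • (Fin.snoc (v j) 1 : Fin (n + 1) → ℝ) =
      (Fin.snoc (fun i => a i + ∑ j, b j * v j i) (∑ j, b j) : Fin (n + 1) → ℝ) := by
  ext k
  refine Fin.lastCases ?_ (fun i => ?_) k
  · simp [Finset.sum_apply, Pi.single_apply]
  · simp [Finset.sum_apply, Pi.single_apply]

/-- If the set covering polyhedron `Q(A)` of the clutter `𝒞` is an integral polyhedron and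
`ℕ𝒜′ = ℤ^{n+1} ∩ ℝ₊𝒜′` (equivalently, the Rees algebra `R[It]` of the edge ideal of `𝒞` is
normal), then `𝒞` has the max-flow min-cut property. -/
theorem stmt7 {n q : ℕ} (E : Fin q → Finset (Fin n)) (hE : IsClutter E)
    (hint : IntegralPolyhedron (incidence E)) (hnor : NormalReesAlgebra (incidence E)) :
    HasMFMC E := by
  intro α
  obtain ⟨x, hx, hxmin⟩ := aux_extreme E hE.1 (fun i => (α i : ℝ)) (fun i => Nat.cast_nonneg _)
  have hxi := hint x hx
  have hxQ := hx.1
  refine ⟨⟨x, hxi, hxQ.1, hxQ.2, fun x' h0 h1 => hxmin x' ⟨h0, h1⟩⟩, ?_⟩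
  set m : ℝ := ∑ i, (α i : ℝ) * x i with hm
  have hm0 : 0 ≤ m := Finset.sum_nonneg fun i _ => mul_nonneg (Nat.cast_nonneg _) (hxQ.1 i)
  obtain ⟨y, hy0, hys, hyα⟩ := aux_duality (incidence E) (fun i => (α i : ℝ))
    (fun i => Nat.cast_nonneg _) m hm0 hxmin
  have hmem : (Fin.snoc (fun i => (α i : ℝ)) m : Fin (n + 1) → ℝ) ∈
      reesSemigroup (incidence E) := by
    rw [hnor]
    refine ⟨⟨fun i => α i - ∑ j, y j * incidence E j i, y, fun i => sub_nonneg.2 (hyα i), hy0, ?_⟩,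
      ?_⟩
    · rw [aux_coord, hys]; simp
    · intro k
      refine Fin.lastCases ?_ (fun i => ?_) k
      · choose z hz using hxi
        refine ⟨∑ i, (α i : ℤ) * z i, ?_⟩
        simp [hm, hz]
      · exact ⟨α i, by simp⟩
  obtain ⟨a, b, hab⟩ := hmem
  rw [aux_coord] at hab
  have hb1 : m = ∑ j, (b j : ℝ) := by
    have := congrFun hab (Fin.last n)
    simpa using this
  have hb2 : ∀ i, (α i : ℝ) = a i + ∑ j, (b j : ℝ) * incidence E j i := by
    intro i
    have := congrFun hab (Fin.castSucc i)
    simpa using this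
  refine ⟨fun j => b j, fun j => ⟨b j, by simp⟩, fun j => Nat.cast_nonneg _, fun i => ?_, ?_⟩
  · have : (0 : ℝ) ≤ a i := Nat.cast_nonneg _
    rw [hb2 i]; linarith
  · intro y' h0 h1
    rw [← hb1]
    calc ∑ j, y' j ≤ ∑ j, y' j * ∑ i, x i * incidence E j i :=
          Finset.sum_le_sum fun j _ => le_mul_of_one_le_right (h0 j) (hxQ.2 j)
      _ = ∑ i, x i * ∑ j, y' j * incidence E j i := by
          simp only [Finset.mul_sum]
          rw [Finset.sum_comm]
          exact Finset.sum_congr rfl fun i _ => Finset.sum_congr rfl fun j _ => by ring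
      _ ≤ ∑ i, x i * α i :=
          Finset.sum_le_sum fun i _ => mul_le_mul_of_nonneg_left (h1 i) (hxQ.1 i)
      _ = m := Finset.sum_congr rfl fun i _ => mul_comm _ _
end

section
/- Let 𝒞 be a clutter with incidence matrix A having columns v_1,…,v_q ∈ {0,1}^n. The integral vertices of the set covering polyhedron Q(A) are precisely the vectors a_k = Σ_{x_i ∈ C_k} e_i, where C_1,…,C_s are the minimal vertex covers of 𝒞. -/
open Finset

/-- `C` is a minimal vertex cover of the clutter with edges `E`: every edge meets `C`, and `C`
is minimal with respect to this property. -/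
def IsMinVertexCover {n q : ℕ} (E : Fin q → Finset (Fin n)) (C : Finset (Fin n)) : Prop :=
  (∀ j, (E j ∩ C).Nonempty) ∧ ∀ C' ⊆ C, (∀ j, (E j ∩ C').Nonempty) → C' = C

theorem aux_sum {n q : ℕ} (E : Fin q → Finset (Fin n)) (y : Fin n → ℝ) (j : Fin q) :
    ∑ i, y i * incidence E j i = ∑ i ∈ E j, y i := by
  simp [incidence]

theorem aux_min {n q : ℕ} (E : Fin q → Finset (Fin n)) (x y : Fin n → ℝ)
    (hx : x ∈ Set.extremePoints ℝ (coveringPolyhedron (incidence E)))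
    (hy : y ∈ coveringPolyhedron (incidence E)) (hle : ∀ i, y i ≤ x i) : y = x := by
  have hz : (fun i => 2 * x i - y i) ∈ coveringPolyhedron (incidence E) := by
    refine ⟨fun i => ?_, fun j => ?_⟩
    · have := hy.1 i
      have := hle i
      show 0 ≤ 2 * x i - y i
      linarith
    · have h1 := hy.2 j
      rw [aux_sum] at h1 ⊢
      refine h1.trans (Finset.sum_le_sum fun i _ => ?_)
      have := hle i
      linarith
  refine (mem_extremePoints.1 hx).2 y hy _ hz ⟨1/2, 1/2, by norm_num, by norm_num, by norm_num, ?_⟩ |>.1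
  funext i
  simp only [Pi.add_apply, Pi.smul_apply, smul_eq_mul]
  ring

theorem aux_cover {n q : ℕ} (E : Fin q → Finset (Fin n)) (C : Finset (Fin n))
    (hC : ∀ j, (E j ∩ C).Nonempty) :
    (fun i => if i ∈ C then (1 : ℝ) else 0) ∈ coveringPolyhedron (incidence E) := by
  refine ⟨fun i => ?_, fun j => ?_⟩
  · show (0:ℝ) ≤ if i ∈ C then (1 : ℝ) else 0
    split_ifs <;> norm_num
  · rw [aux_sum, Finset.sum_ite_mem]
    have := Finset.card_pos.2 (hC j)
    simp only [Finset.sum_const, nsmul_eq_mul, mul_one]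
    exact_mod_cast this

/-- The integral vertices of the set covering polyhedron `Q(A)` of a clutter `𝒞` are precisely
the vectors `a_k = Σ_{x_i ∈ C_k} e_i`, where `C₁, …, C_s` are the minimal vertex covers
of `𝒞`. -/
theorem stmt14 {n q : ℕ} (E : Fin q → Finset (Fin n)) (hE : IsClutter E)
    (x : Fin n → ℝ) :
    (x ∈ Set.extremePoints ℝ (coveringPolyhedron (incidence E)) ∧ IsIntegralVec x) ↔
      ∃ C : Finset (Fin n), IsMinVertexCover E C ∧
        x = fun i => if i ∈ C then (1 : ℝ) else 0 := by
  constructor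
  · rintro ⟨hx, hint⟩
    have hxQ := (mem_extremePoints.1 hx).1
    have hcov : ∀ j, (E j ∩ Finset.univ.filter (fun i => x i ≠ 0)).Nonempty := by
      intro j
      have h := hxQ.2 j
      rw [aux_sum] at h
      obtain ⟨i, hi, hne⟩ := Finset.exists_ne_zero_of_sum_ne_zero
        (show ∑ i ∈ E j, x i ≠ 0 by intro h0; rw [h0] at h; norm_num at h)
      exact ⟨i, by simp [hi, hne]⟩
    have hχ := aux_min E x _ hx (aux_cover E _ hcov) (by
      intro i
      have h0 := hxQ.1 i
      split_ifs with hi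
      · obtain ⟨z, hz⟩ := hint i
        have hne : x i ≠ 0 := by simpa using hi
        have : 0 < x i := lt_of_le_of_ne h0 hne.symm
        rw [hz] at this ⊢
        have hz0 : 0 < z := by exact_mod_cast this
        exact_mod_cast hz0
      · exact h0)
    refine ⟨_, ⟨hcov, fun C' hC' hcov' => ?_⟩, hχ.symm⟩
    have h2 := aux_min E x _ hx (aux_cover E C' hcov') (by
      intro i
      rw [← hχ]
      have := @hC' i
      by_cases h : i ∈ C'
      · simp only [h, this h, if_true, le_refl]
      · simp only [h, if_false]
        split_ifs <;> norm_num)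
    ext i
    have h3 := congrFun h2 i
    by_cases h : i ∈ C'
    · simp [h, hC' h]
    · simp [h] at h3
      simp [h, ← h3]
  · rintro ⟨C, ⟨hcov, hmin⟩, rfl⟩
    refine ⟨mem_extremePoints.2 ⟨aux_cover E C hcov, ?_⟩, ?_⟩
    · rintro y hy z hz ⟨a, b, ha, hb, hab, heq⟩
      have heq' : ∀ i, a * y i + b * z i = if i ∈ C then (1 : ℝ) else 0 :=
        fun i => congrFun heq i
      have hout : ∀ i, i ∉ C → y i = 0 ∧ z i = 0 := by
        intro i hi
        have h := heq' i
        rw [if_neg hi] at h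
        have h1 := mul_nonneg ha.le (hy.1 i)
        have h2 := mul_nonneg hb.le (hz.1 i)
        have h3 : a * y i = 0 := by linarith
        have h4 : b * z i = 0 := by linarith
        exact ⟨(mul_eq_zero.1 h3).resolve_left ha.ne', (mul_eq_zero.1 h4).resolve_left hb.ne'⟩
      have hin : ∀ i, i ∈ C → y i = 1 ∧ z i = 1 := by
        intro i hi
        have hj : ∃ j, ¬ (E j ∩ C.erase i).Nonempty := by
          by_contra hcon
          push Not at hcon
          have := hmin _ (Finset.erase_subset i C) hcon
          have hi' := hi
          rw [← this] at hi'
          exact Finset.notMem_erase i C (by simpa using hi')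
        obtain ⟨j, hj⟩ := hj
        have hE' : ∀ k ∈ E j, k ≠ i → k ∉ C := fun k hk hki hkC =>
          hj ⟨k, by simp [hk, hki, hkC]⟩
        have hij : i ∈ E j := by
          obtain ⟨k, hk⟩ := hcov j
          rw [Finset.mem_inter] at hk
          by_cases hki : k = i
          · exact hki ▸ hk.1
          · exact absurd hk.2 (hE' k hk.1 hki)
        have hy1 := hy.2 j
        have hz1 := hz.2 j
        rw [aux_sum, Finset.sum_eq_single_of_mem i hij
          (fun k hk hki => (hout k (hE' k hk hki)).1)] at hy1
        rw [aux_sum, Finset.sum_eq_single_of_mem i hij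
          (fun k hk hki => (hout k (hE' k hk hki)).2)] at hz1
        have h := heq' i
        rw [if_pos hi] at h
        constructor <;> nlinarith
      constructor
      · funext i
        by_cases h : i ∈ C
        · simp [h, hin i h]
        · simp [h, hout i h]
      · funext i
        by_cases h : i ∈ C
        · simp [h, hin i h]
        · simp [h, hout i h]
    · intro i
      by_cases h : i ∈ C
      · exact ⟨1, by simp [h]⟩
      · exact ⟨0, by simp [h]⟩
end
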